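/- Let α > 0, σ ∈ (0,1), t_c > 0, let δ : ℝ → ℝ be continuous satisfying the modified interval-excitation condition ∫₀^{t_c} δ(τ)² dτ ≥ −(1/α)·ln(1 − σ), let Θ* be a fixed real q×n matrix, and suppose Θ : ℝ → Matrix(q,n,ℝ) satisfies Θ'(t) = α·δ(t)·(δ(t)·Θ* − δ(t)·Θ(t)) for all t ≥ 0. Define s₀(t) = exp(−α·∫₀ᵗ δ(τ)² dτ). Then for every t ≥ t_c one has s₀(t) ≤ 1 − σ < 1 and the finite-time estimate Θ_F(t) := (1/(1 − s₀(t)))·(Θ(t) − s₀(t)·Θ(0)) equals Θ* exactly. -/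

import Mathlib

attribute [local instance] Matrix.frobeniusNormedAddCommGroup Matrix.frobeniusNormedSpace

theorem drem_aux {E : Type*} [NormedAddCommGroup E] [NormedSpace ℝ E]
    (α : ℝ) (δ : ℝ → ℝ) (hδ : Continuous δ) (x : E) (Θ : ℝ → E)
    (hupd : ∀ t ≥ (0 : ℝ), HasDerivAt Θ ((α * δ t) • (δ t • x - δ t • Θ t)) t)
    (t : ℝ) (ht : 0 ≤ t) :
    Θ t - x = Real.exp (-α * ∫ τ in (0 : ℝ)..t, (δ τ) ^ 2) • (Θ 0 - x) := by
  have hI : ∀ s, HasDerivAt (fun u => ∫ τ in (0 : ℝ)..u, (δ τ) ^ 2) ((δ s) ^ 2) s := fun s =>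
    (hδ.pow 2).integral_hasStrictDerivAt 0 s |>.hasDerivAt
  have hg : ∀ s ≥ (0 : ℝ), HasDerivAt
      (fun u => Real.exp (α * ∫ τ in (0 : ℝ)..u, (δ τ) ^ 2) • (Θ u - x)) 0 s := by
    intro s hs
    have h := (((hI s).const_mul α).exp).smul ((hupd s hs).sub_const x)
    refine h.congr_deriv ?_
    module
  have hc := constant_of_has_deriv_right_zero
    (f := fun u => Real.exp (α * ∫ τ in (0 : ℝ)..u, (δ τ) ^ 2) • (Θ u - x)) (a := 0) (b := t)
    (fun s hs => (hg s hs.1).continuousAt.continuousWithinAt)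
    (fun s hs => (hg s hs.1).hasDerivWithinAt) t ⟨ht, le_rfl⟩
  simp only [intervalIntegral.integral_same, mul_zero, Real.exp_zero, one_smul] at hc
  rw [← hc, smul_smul, ← Real.exp_add]
  simp

/-- Finite-time DREM estimation: under the modified interval-excitation condition,
for every `t ≥ t_c` one has `s₀ t ≤ 1 - σ < 1` and the finite-time estimate
`Θ_F t = (1/(1 - s₀ t)) • (Θ t - s₀ t • Θ 0)` equals the true parameter `Θ*`. -/
theorem drem_finite_time_estimation {q n : ℕ}
    (α σ t_c : ℝ) (hα : 0 < α) (hσ : σ ∈ Set.Ioo (0 : ℝ) 1) (htc : 0 < t_c)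
    (δ : ℝ → ℝ) (hδ : Continuous δ)
    (hIE : (∫ τ in (0 : ℝ)..t_c, (δ τ) ^ 2) ≥ -(1 / α) * Real.log (1 - σ))
    (Θstar : Matrix (Fin q) (Fin n) ℝ)
    (Θ : ℝ → Matrix (Fin q) (Fin n) ℝ)
    (hupd : ∀ t ≥ (0 : ℝ), HasDerivAt Θ ((α * δ t) • (δ t • Θstar - δ t • Θ t)) t)
    (s₀ : ℝ → ℝ)
    (hs₀ : ∀ t, s₀ t = Real.exp (-α * ∫ τ in (0 : ℝ)..t, (δ τ) ^ 2)) :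
    ∀ t ≥ t_c,
      s₀ t ≤ 1 - σ ∧ (1 - σ : ℝ) < 1 ∧
      (1 / (1 - s₀ t)) • (Θ t - s₀ t • Θ 0) = Θstar := by
  intro t ht
  obtain ⟨h0, h1⟩ := hσ
  have hle : s₀ t ≤ 1 - σ := by
    rw [hs₀, ← Real.le_log_iff_exp_le (by linarith)]
    have hmono : (∫ τ in (0 : ℝ)..t_c, (δ τ) ^ 2) ≤ ∫ τ in (0 : ℝ)..t, (δ τ) ^ 2 := by
      have hint : ∀ a b : ℝ, IntervalIntegrable (fun τ => (δ τ) ^ 2) MeasureTheory.volume a b :=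
        fun a b => (hδ.pow 2).intervalIntegrable a b
      rw [← intervalIntegral.integral_add_adjacent_intervals (hint 0 t_c) (hint t_c t)]
      have := intervalIntegral.integral_nonneg (μ := MeasureTheory.volume) ht
        (fun u _ => sq_nonneg (δ u))
      linarith
    have h2 := mul_le_mul_of_nonneg_left (le_trans hIE hmono) hα.le
    have h3 : α * (-(1 / α) * Real.log (1 - σ)) = -Real.log (1 - σ) := by
      field_simp
    linarith
  refine ⟨hle, by linarith, ?_⟩
  have h := drem_aux α δ hδ Θstar Θ hupd t (by linarith)
  rw [← hs₀] at h
  have hne : 1 - s₀ t ≠ 0 := by linarith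
  have h4 : Θ t - s₀ t • Θ 0 = (1 - s₀ t) • Θstar := by
    rw [sub_eq_iff_eq_add.mp h]
    module
  rw [h4, smul_smul, one_div, inv_mul_cancel₀ hne, one_smul]
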